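/- (Lemma: shallow-cell bound on doubling constant) If a range space (X, R) has VC-dimension d, shallow-cell complexity φ (i.e., for every Y ⊆ X the number of sets of size ≤ ℓ in R|_Y is at most φ(|Y|, ℓ)), and Alexander's capacity τ, then D_ε ≤ 6·φ(⌈8d·τ(ε)⌉, 24d). -/

import Mathlib

open scoped Classical

noncomputable section

def meas {X : Type*} (P : X → ℝ) (S : Finset X) : ℝ := ∑ x ∈ S, P x

def alexCap {X : Type*} (P : X → ℝ) (R : Finset (Finset X)) (ε : ℝ) : ℝ :=
  sSup {t : ℝ | ∃ ε₀ : ℝ, ε ≤ ε₀ ∧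
    t = meas P ((R.filter fun S => meas P S ≤ ε₀).biUnion id) / ε₀}


theorem edge_bound {α : Type*} [DecidableEq α] (g : Finset α) :
    ∀ (A : Finset (Finset α)) (d : ℕ), (∀ C ∈ A, C ⊆ g) →
      (∀ s, A.Shatters s → s.card ≤ d) →
      ∑ i ∈ g, (A.filter (fun C => i ∉ C ∧ insert i C ∈ A)).card ≤ d * A.card := by
  induction g using Finset.induction_on with
  | empty => intro A d _ _; simp
  | insert a g ha ih =>
    intro A d hA hs
    rw [Finset.sum_insert ha]
    set N := A.nonMemberSubfamily a with hN
    set M := A.memberSubfamily a with hM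
    have mN : ∀ C, C ∈ N ↔ C ∈ A ∧ a ∉ C := fun C => Finset.mem_nonMemberSubfamily
    have mM : ∀ C, C ∈ M ↔ insert a C ∈ A ∧ a ∉ C := fun C => Finset.mem_memberSubfamily
    have hcard : M.card + N.card = A.card := Finset.card_memberSubfamily_add_card_nonMemberSubfamily a A
    have hui : (N ∪ M).card + (N ∩ M).card = N.card + M.card := Finset.card_union_add_card_inter N M
    have h1 : (A.filter (fun C => a ∉ C ∧ insert a C ∈ A)) = N ∩ M := by
      ext C; simp only [Finset.mem_filter, Finset.mem_inter, mN, mM]; tauto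
    rw [h1]
    have subU : ∀ C ∈ N ∪ M, C ⊆ g := by
      intro C hC x hx
      rw [Finset.mem_union, mN, mM] at hC
      rcases hC with ⟨h, h'⟩ | ⟨h, h'⟩
      · have := hA _ h hx
        rw [Finset.mem_insert] at this
        rcases this with rfl | h2
        · exact absurd hx h'
        · exact h2
      · have := hA _ h (Finset.mem_insert_of_mem hx)
        rw [Finset.mem_insert] at this
        rcases this with rfl | h2
        · exact absurd hx h'
        · exact h2
    have notin : ∀ s, (N ∪ M).Shatters s → a ∉ s := by
      intro s h has
      obtain ⟨u, hu, hus⟩ := h (Finset.Subset.refl s)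
      have : a ∈ u := by
        have : a ∈ s ∩ u := by rw [hus]; exact has
        exact (Finset.mem_inter.1 this).2
      exact ha (subU u hu this)
    have shU : ∀ s, (N ∪ M).Shatters s → s.card ≤ d := by
      intro s h
      have has := notin s h
      apply hs
      intro t ht
      obtain ⟨u, hu, hus⟩ := h ht
      rw [Finset.mem_union, mN, mM] at hu
      rcases hu with ⟨h, h'⟩ | ⟨h, h'⟩
      · exact ⟨u, h, hus⟩
      · exact ⟨insert a u, h, by rw [Finset.inter_insert_of_notMem has]; exact hus⟩
    have shI : ∀ s, (N ∩ M).Shatters s → s.card + 1 ≤ d := by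
      intro s h
      have has := notin s (h.mono_left (Finset.inter_subset_union))
      rw [← Finset.card_insert_of_notMem has]
      apply hs
      intro t ht
      have hte : t.erase a ⊆ s := by
        intro x hx
        rw [Finset.mem_erase] at hx
        have := ht hx.2
        rw [Finset.mem_insert] at this
        exact this.resolve_left hx.1
      obtain ⟨u, hu, hus⟩ := h hte
      rw [Finset.mem_inter, mN, mM] at hu
      have key : ∀ x, x ≠ a → ((x ∈ s ∧ x ∈ u) ↔ x ∈ t) := by
        intro x hx
        have := Finset.ext_iff.1 hus x
        rw [Finset.mem_inter, Finset.mem_erase] at this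
        tauto
      by_cases hat : a ∈ t
      · refine ⟨insert a u, hu.2.1, ?_⟩
        ext x
        by_cases hx : x = a
        · subst hx; simp [hat]
        · simp [hx, key x hx]
      · refine ⟨u, hu.1.1, ?_⟩
        ext x
        by_cases hx : x = a
        · subst hx; simp [hat, hu.1.2]
        · simp [hx, key x hx]
    have h2 : ∀ i ∈ g, (A.filter (fun C => i ∉ C ∧ insert i C ∈ A)).card ≤
        ((N ∪ M).filter (fun C => i ∉ C ∧ insert i C ∈ N ∪ M)).card +
        ((N ∩ M).filter (fun C => i ∉ C ∧ insert i C ∈ N ∩ M)).card := by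
      intro i hi
      have hia : a ≠ i := fun h => ha (h ▸ hi)
      set F := (A.filter (fun C => i ∉ C ∧ insert i C ∈ A)) with hF
      have e : (F.memberSubfamily a).card + (F.nonMemberSubfamily a).card = F.card :=
        Finset.card_memberSubfamily_add_card_nonMemberSubfamily a F
      rw [← e, ← Finset.card_union_add_card_inter]
      have mF : ∀ C, C ∈ F ↔ C ∈ A ∧ i ∉ C ∧ insert i C ∈ A := fun C => by
        rw [hF, Finset.mem_filter]
      gcongr
      · intro C hC
        rw [Finset.mem_union, Finset.mem_memberSubfamily, Finset.mem_nonMemberSubfamily, mF, mF] at hC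
        simp only [Finset.mem_filter, Finset.mem_union, mN, mM, Finset.mem_insert, hia, false_or,
          Finset.insert_comm a i C]
        simp only [Finset.mem_insert, Finset.insert_comm i a C] at hC ⊢
        tauto
      · intro C hC
        rw [Finset.mem_inter, Finset.mem_memberSubfamily, Finset.mem_nonMemberSubfamily, mF, mF] at hC
        simp only [Finset.mem_filter, Finset.mem_inter, mN, mM, Finset.mem_insert, hia, false_or]
        simp only [Finset.mem_insert, Finset.insert_comm i a C] at hC ⊢
        tauto
    have h3 := Finset.sum_le_sum h2
    rw [Finset.sum_add_distrib] at h3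
    have h4 := ih (N ∪ M) d subU shU
    by_cases hE : (N ∩ M) = ∅
    · rw [hE] at h3 hui ⊢
      simp only [Finset.filter_empty, Finset.card_empty, Finset.sum_const_zero] at h3 hui ⊢
      rw [← hcard, add_comm M.card, ← hui]
      simp only [add_zero, zero_add] at *
      exact h3.trans h4
    · have hne : (N ∩ M).Shatters ∅ := by
        rw [Finset.shatters_empty]; exact Finset.nonempty_iff_ne_empty.2 hE
      have hd := shI ∅ hne
      obtain ⟨e, rfl⟩ : ∃ e, d = e + 1 := ⟨d - 1, by simp at hd; omega⟩
      have h5 := ih (N ∩ M) e (fun C hC => subU C (Finset.inter_subset_union hC))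
        (fun s h => by have := shI s h; omega)
      rw [← hcard, add_comm M.card, ← hui]
      nlinarith

theorem weighted_edge_bound {α : Type*} [Fintype α] [DecidableEq α] (A : Finset (Finset α)) (d : ℕ)
    (hs : ∀ s, A.Shatters s → s.card ≤ d) (w : Finset α → ℕ) (hw : ∀ C, C ∉ A → w C = 0) :
    ∑ i, ∑ C with i ∉ C, min (w C) (w (insert i C)) ≤ d * ∑ C, w C := by
  set N := ∑ C, w C with hN
  have hle : ∀ C, w C ≤ N := fun C => Finset.single_le_sum (f := w) (fun _ _ => Nat.zero_le _) (Finset.mem_univ C)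
  have cnt : ∀ n ≤ N, n = ∑ t ∈ Finset.range N, if t < n then 1 else 0 := by
    intro n hn
    rw [← Finset.card_filter]
    have : (Finset.range N).filter (fun t => t < n) = Finset.range n := by
      ext t; simp; omega
    rw [this, Finset.card_range]
  set B : ℕ → Finset (Finset α) := fun t => Finset.univ.filter (fun C => t < w C) with hB
  have hBA : ∀ t, B t ⊆ A := by
    intro t C hC
    by_contra h
    have := hw C h
    simp [hB] at hC
    omega
  have h1 : ∑ i, ∑ C with i ∉ C, min (w C) (w (insert i C)) =
      ∑ t ∈ Finset.range N, ∑ i, ((B t).filter (fun C => i ∉ C ∧ insert i C ∈ B t)).card := by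
    rw [Finset.sum_comm]
    refine Finset.sum_congr rfl fun i _ => ?_
    have : ∀ C, min (w C) (w (insert i C)) = ∑ t ∈ Finset.range N, if t < min (w C) (w (insert i C)) then 1 else 0 :=
      fun C => cnt _ ((min_le_left _ _).trans (hle C))
    rw [Finset.sum_congr rfl (fun C _ => this C)]
    rw [Finset.sum_comm]
    refine Finset.sum_congr rfl fun t _ => ?_
    rw [← Finset.card_filter, Finset.filter_filter]
    congr 1
    ext C
    simp [hB]
    tauto
  have h2 : N = ∑ t ∈ Finset.range N, (B t).card := by
    conv_lhs => rw [hN]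
    rw [Finset.sum_congr rfl (fun C _ => cnt (w C) (hle C)), Finset.sum_comm]
    refine Finset.sum_congr rfl fun t _ => ?_
    rw [← Finset.card_filter]
  rw [h1]
  conv_rhs => rw [h2]
  rw [Finset.mul_sum]
  exact Finset.sum_le_sum fun t _ => edge_bound Finset.univ (B t) d (fun _ _ => Finset.subset_univ _)
    (fun s h => hs s (h.mono_left (hBA t)))

theorem class_bound {X : Type*} [Fintype X] (p : X → ℝ) (hp : ∀ x, 0 ≤ p x)
    (K : Finset (Finset X)) (δ : ℝ)
    (hK : ∀ S ∈ K, ∀ T ∈ K, S ≠ T → δ ≤ meas p (symmDiff S T)) (hne : K.Nonempty) :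
    ((K.card : ℝ) - 1) * δ ≤
      2 * ∑ a, p a * ((min (K.filter (fun S => a ∉ S)).card (K.filter (fun S => a ∈ S)).card : ℕ) : ℝ) := by
  have hb : (0:ℝ) < K.card := by exact_mod_cast hne.card_pos
  have h1 : ∀ a, ((K.filter (fun S => a ∉ S)).card : ℝ) * (K.filter (fun S => a ∈ S)).card ≤
      K.card * ((min (K.filter (fun S => a ∉ S)).card (K.filter (fun S => a ∈ S)).card : ℕ) : ℝ) := by
    intro a
    have e := Finset.card_filter_add_card_filter_not (s := K) (fun S => a ∈ S)
    rw [← e]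
    norm_cast
    rcases le_total (K.filter (fun S => a ∉ S)).card (K.filter (fun S => a ∈ S)).card with h | h
    · rw [min_eq_left h]; nlinarith
    · rw [min_eq_right h]; nlinarith
  have h2 : (K.card : ℝ) * ((K.card : ℝ) - 1) * δ ≤ ∑ S ∈ K, ∑ T ∈ K, meas p (symmDiff S T) := by
    have : ∀ S ∈ K, ((K.card : ℝ) - 1) * δ ≤ ∑ T ∈ K, meas p (symmDiff S T) := by
      intro S hS
      rw [← Finset.add_sum_erase K _ hS]
      have h0 : meas p (symmDiff S S) = 0 := by simp [meas]
      rw [h0, zero_add]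
      have := Finset.card_nsmul_le_sum (K.erase S) (fun T => meas p (symmDiff S T)) δ
        (fun T hT => hK S hS T (Finset.mem_of_mem_erase hT) (Finset.ne_of_mem_erase hT).symm)
      rw [Finset.card_erase_of_mem hS, nsmul_eq_mul, Nat.cast_sub hne.card_pos] at this
      simpa using this
    have := Finset.card_nsmul_le_sum K _ _ this
    rw [nsmul_eq_mul] at this
    linarith
  have h3 : ∑ S ∈ K, ∑ T ∈ K, meas p (symmDiff S T) =
      2 * ∑ a, p a * (((K.filter (fun S => a ∉ S)).card : ℝ) * (K.filter (fun S => a ∈ S)).card) := by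
    have hm : ∀ S T : Finset X, meas p (symmDiff S T) =
        ∑ a, p a * ((if a ∉ S then 1 else 0) * (if a ∈ T then 1 else 0) +
          (if a ∈ S then 1 else 0) * (if a ∉ T then 1 else 0)) := by
      intro S T
      unfold meas
      rw [← Finset.sum_filter_add_sum_filter_not Finset.univ (fun a => a ∈ symmDiff S T)]
      rw [Finset.sum_eq_zero (s := Finset.univ.filter (fun a => a ∉ symmDiff S T)), add_zero]
      · rw [Finset.filter_mem_eq_inter, Finset.univ_inter]
        refine Finset.sum_congr rfl fun a ha => ?_
        rw [Finset.mem_symmDiff] at ha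
        rcases ha with ⟨h, h'⟩ | ⟨h, h'⟩ <;> simp [h, h']
      · intro a ha
        simp only [Finset.mem_filter, Finset.mem_symmDiff] at ha
        by_cases h : a ∈ S <;> by_cases h' : a ∈ T <;> simp_all
    simp_rw [hm]
    rw [Finset.sum_congr rfl (fun S _ => Finset.sum_comm), Finset.sum_comm, Finset.mul_sum]
    refine Finset.sum_congr rfl fun a _ => ?_
    simp_rw [← Finset.mul_sum, Finset.sum_add_distrib, ← Finset.mul_sum, ← Finset.sum_mul]
    simp only [Finset.sum_boole]
    ring
  have h4 : ∑ a, p a * (((K.filter (fun S => a ∉ S)).card : ℝ) * (K.filter (fun S => a ∈ S)).card) ≤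
      K.card * ∑ a, p a * ((min (K.filter (fun S => a ∉ S)).card (K.filter (fun S => a ∈ S)).card : ℕ) : ℝ) := by
    rw [Finset.mul_sum]
    refine Finset.sum_le_sum fun a _ => ?_
    have := mul_le_mul_of_nonneg_left (h1 a) (hp a)
    linarith
  refine le_of_mul_le_mul_left ?_ hb
  linarith

def tr {X : Type*} {m : ℕ} (x : Fin m → X) (S : Finset X) : Finset (Fin m) :=
  Finset.univ.filter (fun j => x j ∈ S)

theorem tr_vc {X : Type*} (Q : Finset (Finset X)) (d m : ℕ)
    (hVC : ∀ Y : Finset X, (∀ Z ⊆ Y, ∃ S ∈ Q, S ∩ Y = Z) → Y.card ≤ d) (x : Fin m → X)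
    (s : Finset (Fin m)) (hs : (Q.image (tr x)).Shatters s) : s.card ≤ d := by
  have hinj : Set.InjOn x s := by
    intro i hi j hj hij
    obtain ⟨u, hu, hus⟩ := hs (t := {i}) (by simpa using hi)
    obtain ⟨S, hS, rfl⟩ := Finset.mem_image.1 hu
    have h1 : i ∈ s ∩ tr x S := by rw [hus]; simp
    have h2 : j ∈ s ∩ tr x S := by
      simp only [tr, Finset.mem_inter, Finset.mem_filter, Finset.mem_univ, true_and] at h1 ⊢
      exact ⟨hj, hij ▸ h1.2⟩
    rw [hus] at h2
    exact (Finset.mem_singleton.1 h2).symm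
  rw [← Finset.card_image_of_injOn hinj]
  apply hVC
  intro Z hZ
  obtain ⟨u, hu, hus⟩ := hs (t := s.filter (fun j => x j ∈ Z)) (Finset.filter_subset _ _)
  obtain ⟨S, hS, rfl⟩ := Finset.mem_image.1 hu
  refine ⟨S, hS, ?_⟩
  have key : ∀ j ∈ s, (x j ∈ S ↔ x j ∈ Z) := by
    intro j hj
    have := Finset.ext_iff.1 hus j
    simpa [tr, hj] using this
  ext y
  rw [Finset.mem_inter, Finset.mem_image]
  constructor
  · rintro ⟨h, j, hj, rfl⟩
    exact (key j hj).1 h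
  · intro h
    obtain ⟨j, hj, rfl⟩ := Finset.mem_image.1 (hZ h)
    exact ⟨(key j hj).2 h, j, hj, rfl⟩

theorem sum_weight {X : Type*} [Fintype X] (p : X → ℝ) (hp1 : ∑ x, p x = 1) (m : ℕ) :
    ∑ x : Fin m → X, ∏ j, p (x j) = 1 := by
  rw [← Fintype.sum_pow, hp1, one_pow]

theorem sum_insertNth {X : Type*} [Fintype X] (p : X → ℝ) (m : ℕ) (i : Fin (m + 1))
    (G : (Fin (m + 1) → X) → ℝ) :
    ∑ x : Fin (m + 1) → X, (∏ j, p (x j)) * G x =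
      ∑ y : Fin m → X, (∏ j, p (y j)) * ∑ a, p a * G (Fin.insertNth (α := fun _ => X) i a y) := by
  rw [← (Fin.insertNthEquiv (fun _ => X) i).sum_comp, Fintype.sum_prod_type, Finset.sum_comm]
  refine Finset.sum_congr rfl fun y _ => ?_
  rw [Finset.mul_sum]
  refine Finset.sum_congr rfl fun a _ => ?_
  simp only [Fin.insertNthEquiv_apply]
  rw [Fin.prod_univ_succAbove _ i]
  simp only [Fin.insertNth_apply_same, Fin.insertNth_apply_succAbove]
  have e : Fin.insertNthEquiv (fun _ => X) i (a, y) =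
    Fin.insertNth (α := fun _ => X) i a y := rfl
  rw [e]
  ring

theorem tr_insertNth {X : Type*} {m : ℕ} (i : Fin (m + 1)) (a : X) (y : Fin m → X) (S : Finset X)
    (T : Finset (Fin m)) :
    (tr (Fin.insertNth (α := fun _ => X) i a y) S = T.map i.succAboveEmb ↔ tr y S = T ∧ a ∉ S) ∧
    (tr (Fin.insertNth (α := fun _ => X) i a y) S = insert i (T.map i.succAboveEmb) ↔
      tr y S = T ∧ a ∈ S) := by
  have e : ∀ C : Finset (Fin (m+1)), tr (Fin.insertNth (α := fun _ => X) i a y) S = C ↔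
      (a ∈ S ↔ i ∈ C) ∧ ∀ j, (y j ∈ S ↔ i.succAbove j ∈ C) := by
    intro C
    rw [Finset.ext_iff, Fin.forall_iff_succAbove i]
    simp [tr]
  rw [e, e]
  simp only [Finset.ext_iff, tr, Finset.mem_filter, Finset.mem_univ, true_and, Finset.mem_map,
    Finset.mem_insert, Fin.succAboveEmb_apply, Fin.succAbove_ne, Fin.succAbove_right_inj, 
    and_false, exists_false, exists_eq_right, false_or, true_or, iff_false, iff_true]
  tauto

theorem direction_bound {X : Type*} [Fintype X] (p : X → ℝ) (hp : ∀ x, 0 ≤ p x)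
    (Q : Finset (Finset X)) (δ : ℝ)
    (hQ : ∀ S ∈ Q, ∀ T ∈ Q, S ≠ T → δ ≤ meas p (symmDiff S T)) (m : ℕ) (i : Fin (m + 1))
    (y : Fin m → X) :
    ((Q.card : ℝ) - (Q.image (tr y)).card) * δ ≤ 2 * ∑ a, p a *
      ((∑ C with i ∉ C,
        min (Q.filter (fun S => tr (Fin.insertNth (α := fun _ => X) i a y) S = C)).card
          (Q.filter (fun S => tr (Fin.insertNth (α := fun _ => X) i a y) S = insert i C)).card : ℕ) : ℝ) := by
  set K : Finset (Fin m) → Finset (Finset X) := fun T => Q.filter (fun S => tr y S = T) with hK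
  have h1 : ∀ a, ∑ T ∈ Q.image (tr y), min ((K T).filter (fun S => a ∉ S)).card
      ((K T).filter (fun S => a ∈ S)).card ≤ ∑ C with i ∉ C,
        min (Q.filter (fun S => tr (Fin.insertNth (α := fun _ => X) i a y) S = C)).card
          (Q.filter (fun S => tr (Fin.insertNth (α := fun _ => X) i a y) S = insert i C)).card := by
    intro a
    have hsub : (Q.image (tr y)).map (Finset.mapEmbedding i.succAboveEmb).toEmbedding ⊆
        Finset.univ.filter (fun C => i ∉ C) := by
      intro C hC
      obtain ⟨T, hT, rfl⟩ := Finset.mem_map.1 hC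
      simp [Fin.succAbove_ne]
    refine le_trans (le_of_eq ?_) (Finset.sum_le_sum_of_subset hsub)
    rw [Finset.sum_map]
    refine Finset.sum_congr rfl fun T _ => ?_
    simp only [RelEmbedding.coe_toEmbedding, Finset.mapEmbedding_apply,
      (tr_insertNth i a y _ T).1, (tr_insertNth i a y _ T).2, hK, Finset.filter_filter]
  have h2 : ∀ T ∈ Q.image (tr y), (((K T).card : ℝ) - 1) * δ ≤ 2 * ∑ a, p a *
      ((min ((K T).filter (fun S => a ∉ S)).card ((K T).filter (fun S => a ∈ S)).card : ℕ) : ℝ) := by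
    intro T hT
    apply class_bound p hp
    · intro S hS S' hS' h
      exact hQ S (Finset.mem_filter.1 hS).1 S' (Finset.mem_filter.1 hS').1 h
    · obtain ⟨S, hS, rfl⟩ := Finset.mem_image.1 hT
      exact ⟨S, Finset.mem_filter.2 ⟨hS, rfl⟩⟩
  have h3 := Finset.sum_le_sum h2
  rw [← Finset.sum_mul, Finset.sum_sub_distrib, ← Nat.cast_sum, ← Finset.mul_sum,
    ← Finset.card_eq_sum_card_image (tr y) Q, Finset.sum_comm] at h3
  simp only [Finset.sum_const, nsmul_eq_mul, mul_one] at h3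
  refine h3.trans ?_
  gcongr with a ha
  rw [← Finset.mul_sum, ← Nat.cast_sum]
  exact mul_le_mul_of_nonneg_left (Nat.cast_le.2 (h1 a)) (hp a)

theorem haussler {X : Type*} [Fintype X] (p : X → ℝ) (hp : ∀ x, 0 ≤ p x) (hp1 : ∑ x, p x = 1)
    (Q : Finset (Finset X)) (d : ℕ)
    (hVC : ∀ Y : Finset X, (∀ Z ⊆ Y, ∃ S ∈ Q, S ∩ Y = Z) → Y.card ≤ d) (δ : ℝ)
    (hQ : ∀ S ∈ Q, ∀ T ∈ Q, S ≠ T → δ ≤ meas p (symmDiff S T)) (m : ℕ) :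
    ((m : ℝ) + 1) * (((Q.card : ℝ) -
      ∑ y : Fin m → X, (∏ j, p (y j)) * (Q.image (tr y)).card) * δ) ≤ 2 * (d * Q.card) := by
  set G : Fin (m + 1) → (Fin (m + 1) → X) → ℕ := fun i x => ∑ C with i ∉ C,
    min (Q.filter (fun S => tr x S = C)).card (Q.filter (fun S => tr x S = insert i C)).card with hG
  have hWn : ∀ k, ∀ x : Fin k → X, 0 ≤ ∏ j, p (x j) := fun k x => Finset.prod_nonneg fun j _ => hp _
  have h1 : ∀ x, ∑ i, G i x ≤ d * Q.card := by
    intro x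
    have := weighted_edge_bound (Q.image (tr x)) d (tr_vc Q d (m+1) hVC x)
      (fun C => (Q.filter (fun S => tr x S = C)).card) (by
        intro C hC
        rw [Finset.card_eq_zero, Finset.filter_eq_empty_iff]
        intro S hS h
        exact hC (Finset.mem_image.2 ⟨S, hS, h⟩))
    rw [← Finset.card_eq_sum_card_fiberwise (f := tr x) (s := Q) (t := Finset.univ)
      (fun _ _ => by simp)] at this
    exact this
  have h2 : ∑ i, ∑ x : Fin (m+1) → X, (∏ j, p (x j)) * (G i x : ℝ) ≤ d * Q.card := by
    rw [Finset.sum_comm]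
    calc ∑ x : Fin (m+1) → X, ∑ i, (∏ j, p (x j)) * (G i x : ℝ)
        ≤ ∑ x : Fin (m+1) → X, (∏ j, p (x j)) * (d * Q.card : ℝ) := by
          refine Finset.sum_le_sum fun x _ => ?_
          rw [← Finset.mul_sum]
          refine mul_le_mul_of_nonneg_left ?_ (hWn _ x)
          exact_mod_cast h1 x
      _ = d * Q.card := by rw [← Finset.sum_mul, sum_weight p hp1, one_mul]
  have h3 : ∀ i, ((Q.card : ℝ) - ∑ y : Fin m → X, (∏ j, p (y j)) * (Q.image (tr y)).card) * δ ≤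
      2 * ∑ x : Fin (m+1) → X, (∏ j, p (x j)) * (G i x : ℝ) := by
    intro i
    rw [sum_insertNth p m i (fun x => (G i x : ℝ)), Finset.mul_sum]
    have e : ((Q.card : ℝ) - ∑ y : Fin m → X, (∏ j, p (y j)) * (Q.image (tr y)).card) * δ =
        ∑ y : Fin m → X, (∏ j, p (y j)) * (((Q.card : ℝ) - (Q.image (tr y)).card) * δ) := by
      simp_rw [← mul_assoc, mul_sub]
      rw [← Finset.sum_mul, Finset.sum_sub_distrib, ← Finset.sum_mul, sum_weight p hp1, one_mul]
    rw [e]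
    refine Finset.sum_le_sum fun y _ => ?_
    have := mul_le_mul_of_nonneg_left (direction_bound p hp Q δ hQ m i y) (hWn _ y)
    linarith
  have h4 := Finset.sum_le_sum (fun i (_ : i ∈ (Finset.univ : Finset (Fin (m+1)))) => h3 i)
  rw [Finset.sum_const, Finset.card_univ, Fintype.card_fin, nsmul_eq_mul, ← Finset.mul_sum] at h4
  push_cast at h4
  linarith

theorem sum_coord {X : Type*} [Fintype X] (p : X → ℝ) (hp1 : ∑ x, p x = 1) (m : ℕ)
    (f : X → ℝ) :
    ∑ y : Fin m → X, (∏ j, p (y j)) * ∑ j, f (y j) = m * ∑ a, p a * f a := by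
  simp_rw [Finset.mul_sum]
  rw [Finset.sum_comm]
  rw [← Finset.mul_sum]
  have : ∀ j : Fin m, ∑ y : Fin m → X, (∏ j, p (y j)) * f (y j) = ∑ a, p a * f a := by
    intro j
    cases m with
    | zero => exact j.elim0
    | succ m =>
      rw [sum_insertNth p m j (fun x => f (x j))]
      simp only [Fin.insertNth_apply_same]
      rw [← Finset.sum_mul, sum_weight p hp1, one_mul]
  rw [Finset.sum_congr rfl (fun j _ => this j)]
  simp

theorem shallow {X : Type*} [Fintype X] (p : X → ℝ) (hp : ∀ x, 0 ≤ p x) (hp1 : ∑ x, p x = 1)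
    (R Q : Finset (Finset X)) (hQR : Q ⊆ R) (d : ℕ) (hd : 1 ≤ d) (m N : ℕ) (hmN : m ≤ N)
    (φ : ℕ → ℕ → ℕ)
    (hmono : ∀ a b a' b', a ≤ a' → b ≤ b' → φ a b ≤ φ a' b')
    (hφ : ∀ (Y : Finset X) (ℓ : ℕ),
      ((R.image (· ∩ Y)).filter (fun Z => Z.card ≤ ℓ)).card ≤ φ Y.card ℓ)
    (hsmall : ∀ S ∈ Q, m * meas p S ≤ 8 * d) :
    ∑ y : Fin m → X, (∏ j, p (y j)) * ((Q.image (tr y)).card : ℝ) ≤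
      Q.card / 3 + φ N (24 * d) := by
  have hd0 : (0:ℝ) < d := by exact_mod_cast hd
  have hWn : ∀ k, ∀ x : Fin k → X, 0 ≤ ∏ j, p (x j) := fun k x => Finset.prod_nonneg fun j _ => hp _
  have h1 : ∀ y : Fin m → X, ((Q.image (tr y)).card : ℝ) ≤
      (∑ S ∈ Q, ∑ j, (if y j ∈ S then (1:ℝ) else 0)) / (24 * d) + φ N (24 * d) := by
    intro y
    set Y := Finset.univ.image y with hY
    set B := Q.filter (fun S => 24 * d < (tr y S).card) with hB
    set L := Q.filter (fun S => ¬ 24 * d < (tr y S).card) with hL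
    have a1 : (Q.image (tr y)).card ≤ B.card + (L.image (tr y)).card := by
      have : Q = B ∪ L := (Finset.filter_union_filter_not_eq _ _).symm
      rw [this, Finset.image_union]
      exact (Finset.card_union_le _ _).trans (Nat.add_le_add_right Finset.card_image_le _)
    have a2 : (L.image (tr y)).card ≤ φ N (24 * d) := by
      have b1 : (L.image (tr y)).card ≤ ((R.image (· ∩ Y)).filter (fun Z => Z.card ≤ 24 * d)).card := by
        have : L.image (tr y) ⊆ ((R.image (· ∩ Y)).filter (fun Z => Z.card ≤ 24 * d)).image (tr y) := by
          intro T hT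
          obtain ⟨S, hS, rfl⟩ := Finset.mem_image.1 hT
          obtain ⟨hSQ, hS2⟩ := Finset.mem_filter.1 hS
          refine Finset.mem_image.2 ⟨S ∩ Y, Finset.mem_filter.2
            ⟨Finset.mem_image.2 ⟨S, hQR hSQ, rfl⟩, ?_⟩, ?_⟩
          · have : S ∩ Y ⊆ (tr y S).image y := by
              intro x hx
              obtain ⟨h, h'⟩ := Finset.mem_inter.1 hx
              obtain ⟨j, _, rfl⟩ := Finset.mem_image.1 h'
              exact Finset.mem_image.2 ⟨j, by simp [tr, h], rfl⟩
            exact (Finset.card_le_card this).trans (Finset.card_image_le.trans (not_lt.1 hS2))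
          · ext j
            simp [tr, hY]
        exact (Finset.card_le_card this).trans Finset.card_image_le
      refine b1.trans ((hφ Y _).trans (hmono _ _ _ _ ?_ le_rfl))
      exact (Finset.card_image_le.trans (by simp)).trans hmN
    have a3 : (B.card : ℝ) ≤ (∑ S ∈ Q, ∑ j, (if y j ∈ S then (1:ℝ) else 0)) / (24 * d) := by
      rw [le_div_iff₀ (by positivity)]
      have c1 : B.card • (24 * d : ℝ) ≤ ∑ S ∈ B, ∑ j, (if y j ∈ S then (1:ℝ) else 0) := by
        apply Finset.card_nsmul_le_sum
        intro S hS
        have := (Finset.mem_filter.1 hS).2.le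
        rw [Finset.sum_boole]
        exact_mod_cast this
      rw [nsmul_eq_mul] at c1
      refine c1.trans (Finset.sum_le_sum_of_subset_of_nonneg (Finset.filter_subset _ _) ?_)
      intro S _ _
      exact Finset.sum_nonneg fun j _ => by split_ifs <;> norm_num
    have a4 : ((Q.image (tr y)).card : ℝ) ≤ B.card + φ N (24 * d) := by
      exact_mod_cast a1.trans (Nat.add_le_add_left a2 _)
    linarith
  calc ∑ y : Fin m → X, (∏ j, p (y j)) * ((Q.image (tr y)).card : ℝ)
      ≤ ∑ y : Fin m → X, (∏ j, p (y j)) * ((∑ S ∈ Q, ∑ j, (if y j ∈ S then (1:ℝ) else 0)) / (24 * d)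
          + φ N (24 * d)) :=
        Finset.sum_le_sum fun y _ => mul_le_mul_of_nonneg_left (h1 y) (hWn _ y)
    _ = (∑ S ∈ Q, m * meas p S) / (24 * d) + φ N (24 * d) := by
        simp_rw [mul_add]
        rw [Finset.sum_add_distrib, ← Finset.sum_mul, sum_weight p hp1, one_mul]
        congr 1
        simp_rw [← mul_div_assoc]
        rw [← Finset.sum_div]
        congr 1
        simp_rw [Finset.mul_sum (s := Q)]
        rw [Finset.sum_comm]
        refine Finset.sum_congr rfl fun S _ => ?_
        rw [sum_coord p hp1 m (fun a => if a ∈ S then (1:ℝ) else 0)]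
        simp [meas]
    _ ≤ Q.card / 3 + φ N (24 * d) := by
        have := Finset.sum_le_card_nsmul Q _ _ hsmall
        rw [nsmul_eq_mul] at this
        have : (∑ S ∈ Q, m * meas p S) / (24 * d) ≤ Q.card / 3 := by
          rw [div_le_div_iff₀ (by positivity) (by positivity)]
          linarith
        linarith

theorem alexCap_ge {X : Type*} [Fintype X] (P : X → ℝ)
    (hP : ∀ x, 0 ≤ P x) (hP1 : ∑ x, P x = 1) (R : Finset (Finset X)) (ε ε₁ : ℝ) (hε : 0 < ε)
    (h : ε ≤ ε₁) :
    meas P ((R.filter fun S => meas P S ≤ ε₁).biUnion id) ≤ alexCap P R ε * ε₁ := by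
  rw [← div_le_iff₀ (hε.trans_le h)]
  refine le_csSup ⟨1 / ε, ?_⟩ ⟨ε₁, h, rfl⟩
  rintro t ⟨ε₂, h2, rfl⟩
  have : meas P ((R.filter fun S => meas P S ≤ ε₂).biUnion id) ≤ 1 := by
    rw [← hP1]
    exact Finset.sum_le_sum_of_subset_of_nonneg (Finset.subset_univ _) (fun x _ _ => hP x)
  exact div_le_div₀ zero_le_one this hε h2

/-- Shallow-cell bound on the doubling constant: if the range space has VC-dimension `d`,
shallow-cell complexity `φ` (for every `Y`, the number of traces on `Y` of size at most
`ℓ` is at most `φ(|Y|, ℓ)`), and Alexander's capacity `τ`, then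
`D_ε ≤ 6·φ(⌈8d·τ(ε)⌉, 24d)`. -/
theorem doubling_le_shallow_cell {X : Type*} [Fintype X] (P : X → ℝ)
    (hP : ∀ x, 0 ≤ P x) (hP1 : ∑ x, P x = 1)
    (R : Finset (Finset X)) (d : ℕ) (hd : 1 ≤ d)
    (hVC : ∀ Y : Finset X, (∀ Z ⊆ Y, ∃ S ∈ R, S ∩ Y = Z) → Y.card ≤ d)
    (φ : ℕ → ℕ → ℕ)
    (hmono : ∀ a b a' b', a ≤ a' → b ≤ b' → φ a b ≤ φ a' b')
    (hφ : ∀ (Y : Finset X) (ℓ : ℕ),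
      ((R.image (· ∩ Y)).filter (fun Z => Z.card ≤ ℓ)).card ≤ φ Y.card ℓ)
    (ε : ℝ) (hε : ε ∈ Set.Ioc (0 : ℝ) 1) :
    ∀ ε₀ : ℝ, ε ≤ ε₀ → ∀ Q : Finset (Finset X), Q ⊆ R →
      (∀ S ∈ Q, meas P S ≤ 2 * ε₀) →
      (∀ S₁ ∈ Q, ∀ S₂ ∈ Q, S₁ ≠ S₂ → ε₀ ≤ meas P (symmDiff S₁ S₂)) →
      Q.card ≤ 6 * φ ⌈8 * d * max 1 (alexCap P R ε)⌉₊ (24 * d) := by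
  intro ε₀ hε₀ Q hQR hQm hQs
  have he : 0 < ε₀ := hε.1.trans_le hε₀
  have hd0 : (1:ℝ) ≤ d := by exact_mod_cast hd
  set τ := max 1 (alexCap P R ε) with hτ
  set N := ⌈8 * d * τ⌉₊ with hN
  rcases Nat.lt_or_ge 1 Q.card with hcard | hcard
  swap
  · rcases Q.eq_empty_or_nonempty with rfl | ⟨S, hS⟩
    · simp
    · have h1 := hφ ∅ (24 * d)
      have h2 := hmono 0 (24 * d) N (24 * d) (Nat.zero_le _) le_rfl
      have h3 : 0 < ((R.image (· ∩ (∅ : Finset X))).filter (fun Z => Z.card ≤ 24 * d)).card := by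
        apply Finset.card_pos.2
        exact ⟨∅, Finset.mem_filter.2 ⟨Finset.mem_image.2 ⟨S, hQR hS, by simp⟩, by simp⟩⟩
      rw [Finset.card_empty] at h1
      omega
  set U := Q.biUnion id with hU
  set u := meas P U with hu
  have hsubU : ∀ S ∈ Q, S ⊆ U := fun S hS => Finset.subset_biUnion_of_mem id hS
  have hue : ε₀ ≤ u := by
    obtain ⟨S, hS, T, hT, hne⟩ := Finset.one_lt_card.1 hcard
    refine (hQs S hS T hT hne).trans ?_
    refine Finset.sum_le_sum_of_subset_of_nonneg ?_ (fun x _ _ => hP x)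
    intro x hx
    rcases Finset.mem_symmDiff.1 hx with h | h
    · exact hsubU S hS h.1
    · exact hsubU T hT h.1
  have hu0 : 0 < u := he.trans_le hue
  have huτ : u ≤ τ * (2 * ε₀) := by
    have h1 : u ≤ meas P ((R.filter fun S => meas P S ≤ 2 * ε₀).biUnion id) := by
      refine Finset.sum_le_sum_of_subset_of_nonneg ?_ (fun x _ _ => hP x)
      refine Finset.biUnion_subset_biUnion_of_subset_left _ fun S hS => ?_
      exact Finset.mem_filter.2 ⟨hQR hS, hQm S hS⟩
    refine h1.trans ((alexCap_ge P hP hP1 R ε (2 * ε₀) hε.1 (by linarith)).trans ?_)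
    exact mul_le_mul_of_nonneg_right (le_max_right _ _) (by linarith)
  set p : X → ℝ := fun x => if x ∈ U then P x / u else 0 with hp
  have hpn : ∀ x, 0 ≤ p x := by
    intro x
    simp only [hp]
    split_ifs
    · exact div_nonneg (hP x) hu0.le
    · exact le_rfl
  have hpm : ∀ S ⊆ U, meas p S = meas P S / u := by
    intro S hS
    unfold meas
    rw [Finset.sum_div]
    exact Finset.sum_congr rfl fun x hx => by simp only [hp, if_pos (hS hx)]
  have hp1 : ∑ x, p x = 1 := by
    have h1 := hpm U (Finset.Subset.refl _)
    rw [← hu, div_self hu0.ne'] at h1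
    rw [← h1]
    refine (Finset.sum_subset (Finset.subset_univ U) ?_).symm
    intro x _ hx
    simp only [hp, if_neg hx]
  set r : ℝ := 4 * d * u / ε₀ with hr
  have hr0 : 0 < r := by positivity
  set m := ⌈r⌉₊ - 1 with hm
  have hm1 : m + 1 = ⌈r⌉₊ := Nat.sub_add_cancel (Nat.ceil_pos.2 hr0)
  have hm2 : (m:ℝ) ≤ r := by
    have := Nat.ceil_lt_add_one hr0.le
    rw [← hm1] at this
    push_cast at this
    linarith
  have hm3 : r ≤ (m:ℝ) + 1 := by
    have := Nat.le_ceil r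
    rw [← hm1] at this
    exact_mod_cast this
  have hrN : r ≤ 8 * d * τ := by
    rw [hr, div_le_iff₀ he]
    nlinarith
  have hmN : m ≤ N := by
    have := (hm2.trans hrN).trans (Nat.le_ceil _)
    exact Nat.cast_le.1 this
  have hH := haussler p hpn hp1 Q d
    (fun Y hY => hVC Y fun Z hZ => by
      obtain ⟨S, hS, h⟩ := hY Z hZ
      exact ⟨S, hQR hS, h⟩) (ε₀ / u)
    (by
      intro S hS T hT hne
      rw [hpm]
      · exact div_le_div_of_nonneg_right (hQs S hS T hT hne) hu0.le
      · intro x hx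
        rcases Finset.mem_symmDiff.1 hx with h | h
        · exact hsubU S hS h.1
        · exact hsubU T hT h.1) m
  have hS := shallow p hpn hp1 R Q hQR d hd m N hmN φ hmono hφ (by
    intro S hS
    rw [hpm S (hsubU S hS)]
    have h1 : meas P S / u ≤ 2 * ε₀ / u := div_le_div_of_nonneg_right (hQm S hS) hu0.le
    calc (m:ℝ) * (meas P S / u) ≤ r * (2 * ε₀ / u) :=
          mul_le_mul hm2 h1 (div_nonneg (Finset.sum_nonneg fun x _ => hP x) hu0.le) hr0.le
      _ = 8 * d := by rw [hr]; field_simp; ring)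
  set E := ∑ y : Fin m → X, (∏ j, p (y j)) * ((Q.image (tr y)).card : ℝ) with hE
  have hhalf : (Q.card : ℝ) - E ≤ Q.card / 2 := by
    by_contra hcon
    push Not at hcon
    have hpos : 0 < (Q.card : ℝ) - E := lt_of_le_of_lt (by positivity) hcon
    have h1 : r * (((Q.card : ℝ) - E) * (ε₀ / u)) ≤ 2 * (d * Q.card) :=
      (mul_le_mul_of_nonneg_right hm3 (by positivity)).trans hH
    have h2 : r * (((Q.card : ℝ) - E) * (ε₀ / u)) = 4 * d * ((Q.card : ℝ) - E) := by
      rw [hr]; field_simp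
    rw [h2] at h1
    nlinarith
  have : (Q.card : ℝ) ≤ 6 * φ N (24 * d) := by linarith
  exact_mod_cast this
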